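/- arXiv:1204.2954 — 6 statements merged into one kernel-verified Lean document; each statement's English description precedes it below -/
import Mathlib

section
/- Let X ⊆ ℝ be an interval containing more than one point and let D ⊆ X be a subset that is open in X. Then the following are equivalent: (a) every function f : ℝ → ℝ that is continuous on X and constant on each connected component of D is constant on X; (b) X \ D has empty dense-in-itself kernel, i.e., every nonempty subset S ⊆ X \ D has a point that is isolated in S. -/
open Filter

section

open Set Topology MeasureTheory ProbabilityTheory

/-- A set of reals all of whose nonempty subsets have an isolated point is countable. -/
theorem Set.countable_of_forall_subset_exists_not_accPt {C : Set ℝ}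
    (h : ∀ S ⊆ C, S.Nonempty → ∃ x ∈ S, ¬ AccPt x (𝓟 S)) : C.Countable := by
  by_contra hC
  let K := {x ∈ C | ∀ U ∈ 𝓝 x, ¬ (U ∩ C).Countable}
  have hdiff : (C \ K).Countable := by
    have hU : ∀ x, ∃ U, x ∈ C \ K → U ∈ 𝓝 x ∧ (U ∩ C).Countable := by
      intro x
      by_cases hx : x ∈ C \ K
      · have : ¬ ∀ U ∈ 𝓝 x, ¬ (U ∩ C).Countable := fun hn => hx.2 ⟨hx.1, hn⟩
        push Not at this
        obtain ⟨U, hU⟩ := this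
        exact ⟨U, fun _ => hU⟩
      · exact ⟨∅, fun hx' => absurd hx' hx⟩
    choose U hU using hU
    obtain ⟨t, htK, htc, hcover⟩ := TopologicalSpace.countable_cover_nhdsWithin
      (f := U) (s := C \ K) fun x hx => mem_nhdsWithin_of_mem_nhds (hU x hx).1
    refine (htc.biUnion fun x hx => (hU x (htK hx)).2).mono fun y hy => ?_
    obtain ⟨x, hx, hyx⟩ := mem_iUnion₂.1 (hcover hy)
    exact mem_iUnion₂.2 ⟨x, hx, hyx, hy.1⟩
  have hKne : K.Nonempty := by
    rw [nonempty_iff_ne_empty]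
    intro hK
    rw [hK, sdiff_empty] at hdiff
    exact hC hdiff
  obtain ⟨x, hxK, hx⟩ := h K (fun x hx => hx.1) hKne
  refine hx (accPt_iff_nhds.2 fun U hU => ?_)
  by_contra! hUK
  refine hxK.2 U hU (((countable_singleton x).union hdiff).mono fun y hy => ?_)
  by_cases hyK : y ∈ K
  · exact Or.inl (hUK y ⟨hy.1, hyK⟩)
  · exact Or.inr ⟨hy.2, hyK⟩

/-- A countable preconnected set of reals has at most one point. -/
theorem IsPreconnected.subsingleton_of_countable {s : Set ℝ} (hs : IsPreconnected s)
    (hc : s.Countable) : s.Subsingleton := by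
  have key : ∀ x ∈ s, ∀ y ∈ s, ¬ x < y := by
    intro x hx y hy hxy
    have hIcc := hc.mono (hs.ordConnected.out hx hy)
    rw [← Cardinal.le_aleph0_iff_set_countable, Cardinal.mk_Icc_real hxy] at hIcc
    exact Cardinal.aleph0_lt_continuum.not_ge hIcc
  intro x hx y hy
  exact le_antisymm (not_lt.1 (key y hy x hx)) (not_lt.1 (key x hx y hy))

/-- Every uncountable Borel set of reals carries an atomless Borel probability measure. -/
theorem exists_isProbabilityMeasure_nullSingletonClass_of_not_countable {P : Set ℝ}
    (hP : MeasurableSet P) (hPc : ¬ P.Countable) :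
    ∃ μ : Measure ℝ, IsProbabilityMeasure μ ∧ NullSingletonClass μ ∧ μ Pᶜ = 0 := by
  have : StandardBorelSpace P := hP.standardBorel
  let e : ℝ ≃ᵐ P := PolishSpace.measurableEquivOfNotCountable
    (by rw [← Set.countable_univ_iff]; exact Cardinal.not_countable_real)
    (by rwa [Set.countable_coe_iff])
  let g : ℝ → ℝ := fun t => e t
  have hg : Measurable g := measurable_subtype_coe.comp e.measurable
  have hinj : Function.Injective g := Subtype.val_injective.comp e.injective
  let ν : Measure ℝ := volume.restrict (Icc 0 1)
  have hν : IsProbabilityMeasure ν := ⟨by simp [ν]⟩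
  refine ⟨ν.map g, Measure.isProbabilityMeasure_map hg.aemeasurable, ⟨fun x => ?_⟩, ?_⟩
  · rw [Measure.map_apply hg (measurableSet_singleton x)]
    exact (subsingleton_singleton.preimage hinj).measure_zero ν
  · rw [Measure.map_apply hg hP.compl]
    convert measure_empty (μ := ν)
    ext t
    simp [g]

/-- The cumulative distribution function of an atomless probability measure is continuous. -/
theorem continuous_cdf (μ : Measure ℝ) [IsProbabilityMeasure μ] [NullSingletonClass μ] :
    Continuous (cdf μ) := by
  refine continuous_iff_continuousAt.2 fun x => ?_
  rw [(monotone_cdf μ).continuousAt_iff_leftLim_eq_rightLim, StieltjesFunction.rightLim_eq]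
  have hx : (cdf μ).measure {x} = 0 := by rw [measure_cdf]; exact measure_singleton x
  rw [StieltjesFunction.measure_singleton, ENNReal.ofReal_eq_zero] at hx
  exact le_antisymm ((monotone_cdf μ).leftLim_le le_rfl) (by linarith)

/-- A nonempty dense-in-itself set of reals has a point lying strictly between two others. -/
theorem Preperfect.exists_mem_Ioo {S : Set ℝ} (hS : Preperfect S) (hne : S.Nonempty) :
    ∃ a ∈ S, ∃ b ∈ S, ∃ x ∈ S, x ∈ Ioo a b := by
  rw [preperfect_iff_nhds] at hS
  obtain ⟨x, hx⟩ := hne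
  obtain ⟨y, ⟨-, hy⟩, hyx⟩ := hS x hx univ univ_mem
  obtain ⟨z, ⟨hzy, hz⟩, hzx⟩ := hS x hx {y}ᶜ (isOpen_compl_singleton.mem_nhds hyx.symm)
  have hzy : z ≠ y := hzy
  rcases hyx.lt_or_gt with h1 | h1 <;> rcases hzx.lt_or_gt with h2 | h2 <;>
    rcases hzy.lt_or_gt with h3 | h3
  · exact ⟨z, hz, x, hx, y, hy, h3, h1⟩
  · exact ⟨y, hy, x, hx, z, hz, h3, h2⟩
  · exact ⟨y, hy, z, hz, x, hx, h1, h2⟩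
  · exact ⟨y, hy, z, hz, x, hx, h1, h2⟩
  · exact ⟨z, hz, y, hy, x, hx, h2, h1⟩
  · exact ⟨z, hz, y, hy, x, hx, h2, h1⟩
  · exact ⟨x, hx, y, hy, z, hz, h2, h3⟩
  · exact ⟨x, hx, z, hz, y, hy, h1, h3⟩

/-- If `P ⊆ [a, b]` is an uncountable Borel set, then some continuous function takes the values
`0` at `a` and `1` at `b` and is constant on every preconnected set disjoint from `P`. -/
theorem exists_continuous_eq_on_isPreconnected_disjoint {P : Set ℝ} {a b : ℝ}
    (hP : MeasurableSet P) (hPc : ¬ P.Countable) (hPab : P ⊆ Icc a b) :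
    ∃ f : ℝ → ℝ, Continuous f ∧ f a = 0 ∧ f b = 1 ∧
      ∀ s, IsPreconnected s → Disjoint s P → ∀ x ∈ s, ∀ y ∈ s, f x = f y := by
  obtain ⟨μ, _, _, hμ⟩ := exists_isProbabilityMeasure_nullSingletonClass_of_not_countable hP hPc
  refine ⟨cdf μ, continuous_cdf μ, ?_, ?_, fun s hs hsP => ?_⟩
  · have h0 : μ (Iic a) = 0 := by
      rw [← measure_congr (Iio_ae_eq_Iic (a := a))]
      exact measure_mono_null
        (fun x (hx : x < a) (hxP : x ∈ P) => not_le.2 hx (hPab hxP).1) hμ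
    simp [cdf_eq_real, measureReal_def, h0]
  · have h1 : μ (Iic b)ᶜ = 0 :=
      measure_mono_null (compl_subset_compl.2 fun x hx => (hPab hx).2) hμ
    rw [prob_compl_eq_zero_iff measurableSet_Iic] at h1
    simp [cdf_eq_real, measureReal_def, h1]
  · have key : ∀ x ∈ s, ∀ y ∈ s, x ≤ y → cdf μ x = cdf μ y := by
      intro x hx y hy hxy
      have h0 : (cdf μ).measure (Ioc x y) = 0 := by
        rw [measure_cdf]
        exact measure_mono_null (fun z hz hzP => hsP.le_bot
          ⟨hs.ordConnected.out hx hy (Ioc_subset_Icc_self hz), hzP⟩) hμ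
      rw [StieltjesFunction.measure_Ioc, ENNReal.ofReal_eq_zero] at h0
      exact le_antisymm (monotone_cdf μ hxy) (by linarith)
    intro x hx y hy
    rcases le_total x y with hxy | hxy
    · exact key x hx y hy hxy
    · exact (key y hy x hx hxy).symm

/-- A function that is constant on the connected components of a relatively open subset `D` of a
nontrivial interval takes only countably many values on `D`. -/
theorem countable_image_of_const_on_connectedComponentIn {X D U : Set ℝ} {f : ℝ → ℝ}
    (hX : X.OrdConnected) (hX2 : X.Nontrivial) (hU : IsOpen U) (hD : D = U ∩ X)
    (hf : ∀ x ∈ D, ∀ y ∈ connectedComponentIn D x, f y = f x) : (f '' D).Countable := by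
  refine (countable_range fun q : ℚ => f q).mono ?_
  rintro _ ⟨x, hx, rfl⟩
  have hxU : x ∈ U := (hD ▸ hx).1
  have hxX : x ∈ X := (hD ▸ hx).2
  obtain ⟨ε, hε, hball⟩ := Metric.isOpen_iff.1 hU x hxU
  have of_segment : ∀ y, ∀ q : ℚ, Icc (min x y) (max x y) ⊆ D →
      (q : ℝ) ∈ Icc (min x y) (max x y) → f x ∈ range fun q : ℚ => f q := by
    intro y q hsub hq
    exact ⟨q, hf x hx q (isPreconnected_Icc.subset_connectedComponentIn
      ⟨min_le_left _ _, le_max_left _ _⟩ hsub hq)⟩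
  rw [Real.ball_eq_Ioo] at hball
  obtain ⟨y, hy, hyx⟩ := hX2.exists_ne x
  rcases hyx.lt_or_gt with h | h
  · have hlt : max y (x - ε / 2) < x := max_lt h (by linarith)
    obtain ⟨q, hq1, hq2⟩ := exists_rat_btwn hlt
    refine of_segment (max y (x - ε / 2)) q ?_ ?_
    · rw [min_eq_right hlt.le, max_eq_left hlt.le, hD]
      intro z hz
      have hz1 := max_le_iff.1 hz.1
      exact ⟨hball ⟨by linarith, by linarith [hz.2]⟩, hX.out hy hxX ⟨hz1.1, hz.2⟩⟩
    · rw [min_eq_right hlt.le, max_eq_left hlt.le]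
      exact ⟨hq1.le, hq2.le⟩
  · have hlt : x < min y (x + ε / 2) := lt_min h (by linarith)
    obtain ⟨q, hq1, hq2⟩ := exists_rat_btwn hlt
    refine of_segment (min y (x + ε / 2)) q ?_ ?_
    · rw [min_eq_left hlt.le, max_eq_right hlt.le, hD]
      intro z hz
      have hz2 := le_min_iff.1 hz.2
      exact ⟨hball ⟨by linarith [hz.1], by linarith⟩, hX.out hxX hy ⟨hz.1, hz2.1⟩⟩
    · rw [min_eq_left hlt.le, max_eq_right hlt.le]
      exact ⟨hq1.le, hq2.le⟩

end

/-- Lemma 2 (Lai): for an interval `X ⊆ ℝ` with more than one point and a subset `D`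
open in `X`, every continuous `D`-piecewise constant function on `X` is constant on `X`
iff `X \ D` has empty dense-in-itself kernel, i.e. every nonempty subset of `X \ D`
has a point isolated in it. -/
theorem piecewise_constant_iff_empty_denseInItself_kernel
    (X D : Set ℝ) (hX : X.OrdConnected) (hX2 : X.Nontrivial)
    (hDX : D ⊆ X) (hDopen : ∃ U : Set ℝ, IsOpen U ∧ D = U ∩ X) :
    (∀ f : ℝ → ℝ, ContinuousOn f X →
        (∀ x ∈ D, ∀ y ∈ connectedComponentIn D x, f y = f x) →
        ∀ x ∈ X, ∀ y ∈ X, f x = f y) ↔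
      (∀ S : Set ℝ, S ⊆ X \ D → S.Nonempty → ∃ x ∈ S, ¬ AccPt x (𝓟 S)) := by
  constructor
  · intro h S hS hne
    by_contra! hacc
    obtain ⟨U, hU, hD⟩ := hDopen
    have hperf : Preperfect S := hacc
    obtain ⟨a, ha, b, hb, x, hx, hxab⟩ := hperf.exists_mem_Ioo hne
    let P := closure (Set.Ioo a b ∩ S)
    have hPab : P ⊆ Set.Icc a b :=
      closure_minimal (Set.inter_subset_left.trans Set.Ioo_subset_Icc_self) isClosed_Icc
    have hPD : Disjoint D P := by
      refine Set.disjoint_left.2 fun y hyD hyP => ?_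
      have hPU : P ⊆ Uᶜ := closure_minimal
        (fun z hz hzU => (hS hz.2).2 (hD ▸ ⟨hzU, (hS hz.2).1⟩)) hU.isClosed_compl
      exact hPU hyP (hD ▸ hyD).1
    have hPc : ¬ P.Countable := by
      intro hc
      obtain ⟨g, hgP, -, hg⟩ := (hperf.open_inter isOpen_Ioo).perfect_closure
        |>.exists_nat_bool_injection ⟨x, subset_closure ⟨hxab, hx⟩⟩
      have : Countable (ℕ → Bool) := Set.countable_univ_iff.1
        (Set.countable_of_injective_of_countable_image hg.injOn
          (hc.mono (by rwa [Set.image_univ])))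
      rw [← Cardinal.mk_le_aleph0_iff] at this
      simp [Cardinal.aleph0_lt_continuum.not_ge] at this
    obtain ⟨f, hf, hfa, hfb, hconst⟩ :=
      exists_continuous_eq_on_isPreconnected_disjoint isClosed_closure.measurableSet hPc hPab
    have hab := h f hf.continuousOn (fun y hy z hz =>
      hconst _ isPreconnected_connectedComponentIn
        (hPD.mono_left (connectedComponentIn_subset D y)) z hz y (mem_connectedComponentIn hy))
      a (hS ha).1 b (hS hb).1
    rw [hfa, hfb] at hab
    exact zero_ne_one hab
  · intro h f hf hconst x hx y hy
    obtain ⟨U, hU, hD⟩ := hDopen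
    have hcount : (f '' X).Countable := by
      rw [← Set.sdiff_union_of_subset hDX, Set.image_union]
      exact ((Set.countable_of_forall_subset_exists_not_accPt h).image f).union
        (countable_image_of_const_on_connectedComponentIn hX hX2 hU hD hconst)
    exact (hX.isPreconnected.image f hf).subsingleton_of_countable hcount
      (Set.mem_image_of_mem f hx) (Set.mem_image_of_mem f hy)
end

section
/- Let X ⊆ ℝ be an interval containing more than one point and let D ⊆ X be a subset that is open in X and dense in X. If f : ℝ → ℝ is continuously differentiable on X (C¹ on X, derivatives taken within X) and f is constant on each connected component of D, then f is constant on X (this holds even if X \ D has non-empty dense-in-itself kernel). -/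
open Filter

/-- A subset of an interval `X` that is open in `X` contains, around each of its points, a
neighbourhood in `X` lying in a single connected component. -/
theorem connectedComponentIn_inter_mem_nhdsWithin {X U : Set ℝ} (hX : X.OrdConnected)
    (hU : IsOpen U) {x : ℝ} (hx : x ∈ U ∩ X) :
    connectedComponentIn (U ∩ X) x ∈ nhdsWithin x X := by
  obtain ⟨ε, hε, hball⟩ := Metric.isOpen_iff.1 hU x hx.1
  have hconn : (Metric.ball x ε ∩ X).OrdConnected :=
    (convex_ball x ε).ordConnected.inter hX
  refine mem_of_superset
    (inter_mem (mem_nhdsWithin_of_mem_nhds (Metric.ball_mem_nhds x hε)) self_mem_nhdsWithin) ?_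
  exact hconn.isPreconnected.subset_connectedComponentIn ⟨Metric.mem_ball_self hε, hx.2⟩
    (Set.inter_subset_inter_left X hball)

/-- If `X ⊆ ℝ` is an interval with more than one point, `D ⊆ X` is open in `X` and
dense in `X`, then any function that is `C¹` on `X` (derivatives within `X`) and
constant on each connected component of `D` is constant on `X`, even if `X \ D`
has non-empty dense-in-itself kernel. -/
theorem c1_piecewise_constant_of_dense
    (X D : Set ℝ) (hX : X.OrdConnected) (hX2 : X.Nontrivial)
    (hDX : D ⊆ X) (hDopen : ∃ U : Set ℝ, IsOpen U ∧ D = U ∩ X)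
    (hDdense : X ⊆ closure D)
    (f : ℝ → ℝ) (hf : ContDiffOn ℝ 1 f X)
    (hpc : ∀ x ∈ D, ∀ y ∈ connectedComponentIn D x, f y = f x) :
    ∀ x ∈ X, ∀ y ∈ X, f x = f y := by
  obtain ⟨U, hU, rfl⟩ := hDopen
  have huniq : UniqueDiffOn ℝ X :=
    uniqueDiffOn_convex hX.convex (hX.convex.nontrivial_iff_nonempty_interior.1 hX2)
  have hzero : Set.EqOn (fderivWithin ℝ f X) (fun _ => 0) (U ∩ X) := by
    intro x hx
    have hloc : f =ᶠ[nhdsWithin x X] fun _ => f x :=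
      mem_of_superset (connectedComponentIn_inter_mem_nhdsWithin hX hU hx) (hpc x hx)
    rw [hloc.fderivWithin_eq rfl]
    simp
  have hzeroX : Set.EqOn (fderivWithin ℝ f X) (fun _ => 0) X :=
    hzero.of_subset_closure (hf.continuousOn_fderivWithin huniq le_rfl) continuousOn_const
      hDX hDdense
  intro x hx y hy
  exact hX.convex.is_const_of_fderivWithin_eq_zero (𝕜 := ℝ) (hf.differentiableOn one_ne_zero)
    hzeroX hx hy
end

section
/- Let (α, β, σ, λ, μ) together with the Frenet apparatuses (T, N, B, κ, τ; ε₁, ε₂) of α and (T̃, Ñ, B̃, κ̃, τ̃; ε̃₁, ε̃₂) of β form a non-null Mannheim pair. Then λ is a constant function on ℝ; in particular the quantity ⟪α(s) − β(σ(s)), α(s) − β(σ(s))⟫ is constant in s, i.e., the distance between corresponding points is constant. -/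
noncomputable def mink (x y : Fin 3 → ℝ) : ℝ :=
  -(x 0 * y 0) + x 1 * y 1 + x 2 * y 2

/-- A Frenet apparatus with signs `(ε₁, ε₂)` for a smooth curve `γ : ℝ → ℝ³`
in Minkowski 3-space. -/
structure FrenetApparatus (γ T N B : ℝ → Fin 3 → ℝ) (κ τ : ℝ → ℝ) (ε₁ ε₂ : ℝ) : Prop where
  smooth_curve : ContDiff ℝ (⊤ : ℕ∞) γ
  smooth_T : ContDiff ℝ (⊤ : ℕ∞) T
  smooth_N : ContDiff ℝ (⊤ : ℕ∞) N
  smooth_B : ContDiff ℝ (⊤ : ℕ∞) B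
  smooth_curv : ContDiff ℝ (⊤ : ℕ∞) κ
  smooth_tors : ContDiff ℝ (⊤ : ℕ∞) τ
  sign1 : ε₁ = 1 ∨ ε₁ = -1
  sign2 : ε₂ = 1 ∨ ε₂ = -1
  tangent : ∀ s, T s = deriv γ s
  inner_TT : ∀ s, mink (T s) (T s) = ε₁
  inner_NN : ∀ s, mink (N s) (N s) = ε₂
  inner_BB : ∀ s, mink (B s) (B s) = -ε₂
  inner_TN : ∀ s, mink (T s) (N s) = 0
  inner_TB : ∀ s, mink (T s) (B s) = 0
  inner_NB : ∀ s, mink (N s) (B s) = 0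
  frenet_T : ∀ s, deriv T s = κ s • N s
  frenet_N : ∀ s, deriv N s = (-(ε₁ * ε₂) * κ s) • T s + τ s • B s
  frenet_B : ∀ s, deriv B s = (ε₁ * τ s) • N s

/-- A non-null Mannheim pair `(α, β, σ, λ, μ)` together with Frenet apparatuses
`(T, N, B, κ, τ; ε₁, ε₂)` of `α` and `(T', N', B', κ', τ'; ε₁', ε₂')` of `β`. -/
structure MannheimPair (α β T N B : ℝ → Fin 3 → ℝ) (κ τ : ℝ → ℝ) (ε₁ ε₂ : ℝ)
    (T' N' B' : ℝ → Fin 3 → ℝ) (κ' τ' : ℝ → ℝ) (ε₁' ε₂' : ℝ)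
    (σ lam : ℝ → ℝ) (μ : ℝ) : Prop where
  frenet_fst : FrenetApparatus α T N B κ τ ε₁ ε₂
  frenet_snd : FrenetApparatus β T' N' B' κ' τ' ε₁' ε₂'
  smooth_repar : ContDiff ℝ (⊤ : ℕ∞) σ
  surj_repar : Function.Surjective σ
  deriv_repar_pos : ∀ s, 0 < deriv σ s
  smooth_lam : ContDiff ℝ (⊤ : ℕ∞) lam
  sign_mu : μ = 1 ∨ μ = -1
  mannheim_eq : ∀ s, α s = β (σ s) + lam (σ s) • B' (σ s)
  binormal_eq : ∀ s, B' (σ s) = μ • N s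

/-- The hyperbolic-angle hypothesis relating the frames of a non-null Mannheim pair. -/
def HypAngle (T B T' N' : ℝ → Fin 3 → ℝ) (σ φ : ℝ → ℝ) : Prop :=
  ContDiff ℝ (⊤ : ℕ∞) φ ∧
  (∀ s, T s = Real.cosh (φ s) • T' (σ s) + Real.sinh (φ s) • N' (σ s)) ∧
  (∀ s, B s = Real.sinh (φ s) • T' (σ s) + Real.cosh (φ s) • N' (σ s))

/-- The real-angle hypothesis (Case 3) relating the frames of a non-null Mannheim pair. -/
def RealAngle (T B T' N' : ℝ → Fin 3 → ℝ) (σ φ : ℝ → ℝ) : Prop :=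
  ContDiff ℝ (⊤ : ℕ∞) φ ∧
  (∀ s, T s = Real.cos (φ s) • T' (σ s) + Real.sin (φ s) • N' (σ s)) ∧
  (∀ s, B s = -Real.sin (φ s) • T' (σ s) + Real.cos (φ s) • N' (σ s))

theorem mink_add_left (x y z : Fin 3 → ℝ) : mink (x + y) z = mink x z + mink y z := by
  simp only [mink, Pi.add_apply]
  ring

theorem mink_smul_left (c : ℝ) (x y : Fin 3 → ℝ) : mink (c • x) y = c * mink x y := by
  simp only [mink, Pi.smul_apply, smul_eq_mul]
  ring

theorem mink_smul_right (c : ℝ) (x y : Fin 3 → ℝ) : mink x (c • y) = c * mink x y := by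
  simp only [mink, Pi.smul_apply, smul_eq_mul]
  ring

section MannheimPair

variable {α β T N B T' N' B' : ℝ → Fin 3 → ℝ} {κ τ κ' τ' σ lam : ℝ → ℝ}
  {ε₁ ε₂ ε₁' ε₂' μ : ℝ}

/-- The tangent of the first curve, expressed in the frame of the second one. -/
theorem MannheimPair.tangent_eq
    (h : MannheimPair α β T N B κ τ ε₁ ε₂ T' N' B' κ' τ' ε₁' ε₂' σ lam μ) (s : ℝ) :
    T s = deriv σ s • (T' (σ s) + (lam (σ s) • (ε₁' * τ' (σ s)) • N' (σ s)
      + deriv lam (σ s) • B' (σ s))) := by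
  have hβ : HasDerivAt β (T' (σ s)) (σ s) := by
    rw [h.frenet_snd.tangent]
    exact (h.frenet_snd.smooth_curve.differentiable (by simp) _).hasDerivAt
  have hB : HasDerivAt B' ((ε₁' * τ' (σ s)) • N' (σ s)) (σ s) := by
    rw [← h.frenet_snd.frenet_B]
    exact (h.frenet_snd.smooth_B.differentiable (by simp) _).hasDerivAt
  have hlam : HasDerivAt lam (deriv lam (σ s)) (σ s) :=
    (h.smooth_lam.differentiable (by simp) _).hasDerivAt
  have hσ : HasDerivAt σ (deriv σ s) s :=
    (h.smooth_repar.differentiable (by simp) _).hasDerivAt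
  have hα : α = (fun u => β u + lam u • B' u) ∘ σ := funext h.mannheim_eq
  rw [h.frenet_fst.tangent, hα]
  exact ((hβ.add (hlam.smul hB)).scomp s hσ).deriv

theorem MannheimPair.deriv_lam_eq_zero
    (h : MannheimPair α β T N B κ τ ε₁ ε₂ T' N' B' κ' τ' ε₁' ε₂' σ lam μ) (u : ℝ) :
    deriv lam u = 0 := by
  obtain ⟨s, rfl⟩ := h.surj_repar u
  have horth : mink (T s) (B' (σ s)) = 0 := by
    rw [h.binormal_eq, mink_smul_right, h.frenet_fst.inner_TN, mul_zero]
  rw [h.tangent_eq] at horth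
  simp only [mink_add_left, mink_smul_left, h.frenet_snd.inner_TB, h.frenet_snd.inner_NB,
    h.frenet_snd.inner_BB, mul_zero, zero_add] at horth
  have hε : ε₂' ≠ 0 := by
    rcases h.frenet_snd.sign2 with h2 | h2 <;> norm_num [h2]
  simpa [(h.deriv_repar_pos s).ne', hε] using horth

end MannheimPair

/-- For a non-null Mannheim pair, `λ` is constant; in particular the (Minkowski)
distance between corresponding points is constant. -/
theorem mannheim_dist_constant
    (α β T N B T' N' B' : ℝ → Fin 3 → ℝ) (κ τ κ' τ' σ lam : ℝ → ℝ)
    (ε₁ ε₂ ε₁' ε₂' μ : ℝ)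
    (hpair : MannheimPair α β T N B κ τ ε₁ ε₂ T' N' B' κ' τ' ε₁' ε₂' σ lam μ) :
    (∀ s t, lam s = lam t) ∧
      (∀ s t, mink (α s - β (σ s)) (α s - β (σ s)) =
              mink (α t - β (σ t)) (α t - β (σ t))) := by
  have hconst : ∀ s t, lam s = lam t :=
    is_const_of_deriv_eq_zero (hpair.smooth_lam.differentiable (by simp))
      hpair.deriv_lam_eq_zero
  refine ⟨hconst, fun s t => ?_⟩
  have hdist : ∀ u, mink (α u - β (σ u)) (α u - β (σ u)) =
      lam (σ u) * (lam (σ u) * -ε₂') := fun u => by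
    rw [hpair.mannheim_eq, add_sub_cancel_left, mink_smul_left, mink_smul_right,
      hpair.frenet_snd.inner_BB]
  rw [hdist, hdist, hconst (σ s) (σ t)]
end

section
/- Let (α, β, σ, λ, μ) with Frenet apparatuses (T, N, B, κ, τ; ε₁, ε₂) and (T̃, Ñ, B̃, κ̃, τ̃; ε̃₁, ε̃₂) form a non-null Mannheim pair satisfying the hyperbolic-angle hypothesis with angle function φ, and assume that λ(σ(s)) ≠ 0, κ(s) ≠ 0, τ(s) ≠ 0 and 1 + ε₁·ε₂·λ(σ(s))·μ·κ(s) ≠ 0 for all s. Then the angle φ is a constant function if and only if both κ and τ are constant functions. -/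
theorem mink_comm (x y : Fin 3 → ℝ) : mink x y = mink y x := by
  simp only [mink]; ring

namespace FrenetApparatus

variable {γ T N B : ℝ → Fin 3 → ℝ} {κ τ : ℝ → ℝ} {ε₁ ε₂ : ℝ}

theorem sign1_mul_self (h : FrenetApparatus γ T N B κ τ ε₁ ε₂) : ε₁ * ε₁ = 1 := by
  rcases h.sign1 with h | h <;> simp [h]

theorem sign1_ne_zero (h : FrenetApparatus γ T N B κ τ ε₁ ε₂) : ε₁ ≠ 0 := by
  rcases h.sign1 with h | h <;> simp [h]

theorem sign2_ne_zero (h : FrenetApparatus γ T N B κ τ ε₁ ε₂) : ε₂ ≠ 0 := by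
  rcases h.sign2 with h | h <;> simp [h]

theorem hasDerivAt_curve (h : FrenetApparatus γ T N B κ τ ε₁ ε₂) (s : ℝ) :
    HasDerivAt γ (T s) s := by
  rw [h.tangent]
  exact (h.smooth_curve.differentiable (by simp) s).hasDerivAt

theorem hasDerivAt_T (h : FrenetApparatus γ T N B κ τ ε₁ ε₂) (s : ℝ) :
    HasDerivAt T (κ s • N s) s := by
  rw [← h.frenet_T]
  exact (h.smooth_T.differentiable (by simp) s).hasDerivAt

theorem hasDerivAt_N (h : FrenetApparatus γ T N B κ τ ε₁ ε₂) (s : ℝ) :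
    HasDerivAt N ((-(ε₁ * ε₂) * κ s) • T s + τ s • B s) s := by
  rw [← h.frenet_N]
  exact (h.smooth_N.differentiable (by simp) s).hasDerivAt

theorem hasDerivAt_B (h : FrenetApparatus γ T N B κ τ ε₁ ε₂) (s : ℝ) :
    HasDerivAt B ((ε₁ * τ s) • N s) s := by
  rw [← h.frenet_B]
  exact (h.smooth_B.differentiable (by simp) s).hasDerivAt

/-- The coefficients of a vanishing combination of the frame are zero. -/
theorem coeff_eq_zero (h : FrenetApparatus γ T N B κ τ ε₁ ε₂) (s : ℝ) {a b c : ℝ}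
    (habc : a • T s + b • N s + c • B s = 0) : a = 0 ∧ b = 0 ∧ c = 0 := by
  have key (v : Fin 3 → ℝ) :
      a * mink (T s) v + b * mink (N s) v + c * mink (B s) v = 0 := by
    rw [← mink_smul_left, ← mink_smul_left, ← mink_smul_left, ← mink_add_left,
      ← mink_add_left, habc]
    simp [mink]
  have hT := key (T s)
  have hN := key (N s)
  have hB := key (B s)
  rw [h.inner_TT, mink_comm (N s), h.inner_TN, mink_comm (B s), h.inner_TB] at hT
  rw [h.inner_TN, h.inner_NN, mink_comm (B s), h.inner_NB] at hN
  rw [h.inner_TB, h.inner_NB, h.inner_BB] at hB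
  simpa [h.sign1_ne_zero, h.sign2_ne_zero] using And.intro hT (And.intro hN hB)

end FrenetApparatus

/-- The hyperbolic rotation of the hyperbolic-angle hypothesis, solved for the tangent of the
conjugate curve. -/
theorem HypAngle.tangent_eq {T B T' N' : ℝ → Fin 3 → ℝ} {σ φ : ℝ → ℝ}
    (h : HypAngle T B T' N' σ φ) (s : ℝ) :
    T' (σ s) = Real.cosh (φ s) • T s - Real.sinh (φ s) • B s := by
  rw [h.2.1, h.2.2]
  have hcs := Real.cosh_sq_sub_sinh_sq (φ s)
  linear_combination (norm := module) (-hcs) • T' (σ s)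

namespace MannheimPair

variable {α β T N B T' N' B' : ℝ → Fin 3 → ℝ} {κ τ κ' τ' σ lam φ : ℝ → ℝ}
  {ε₁ ε₂ ε₁' ε₂' μ : ℝ}

theorem mu_ne_zero
    (h : MannheimPair α β T N B κ τ ε₁ ε₂ T' N' B' κ' τ' ε₁' ε₂' σ lam μ) : μ ≠ 0 := by
  rcases h.sign_mu with h | h <;> simp [h]

theorem differentiable_repar
    (h : MannheimPair α β T N B κ τ ε₁ ε₂ T' N' B' κ' τ' ε₁' ε₂' σ lam μ) :
    Differentiable ℝ σ :=
  h.smooth_repar.differentiable (by simp)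

theorem differentiable_lam_comp
    (h : MannheimPair α β T N B κ τ ε₁ ε₂ T' N' B' κ' τ' ε₁' ε₂' σ lam μ) :
    Differentiable ℝ (fun s => lam (σ s)) :=
  (h.smooth_lam.differentiable (by simp)).comp h.differentiable_repar

/-- The components of the derivative of `α = β ∘ σ + (lam ∘ σ) • B' ∘ σ` in the frame of `α`. -/
theorem tangent_components
    (h : MannheimPair α β T N B κ τ ε₁ ε₂ T' N' B' κ' τ' ε₁' ε₂' σ lam μ)
    (hφ : HypAngle T B T' N' σ φ) (s : ℝ) :
    1 + ε₁ * ε₂ * lam (σ s) * μ * κ s = deriv σ s * Real.cosh (φ s) ∧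
      deriv (fun s => lam (σ s)) s = 0 ∧
      lam (σ s) * μ * τ s = deriv σ s * Real.sinh (φ s) := by
  have hα : α = fun s => β (σ s) + (lam (σ s) * μ) • N s := by
    funext s
    rw [h.mannheim_eq, h.binormal_eq, smul_smul]
  have hd := ((h.frenet_snd.hasDerivAt_curve (σ s)).scomp s
    (h.differentiable_repar s).hasDerivAt).add
    (((h.differentiable_lam_comp s).hasDerivAt.mul_const μ).smul
      (h.frenet_fst.hasDerivAt_N s))
  have hT := h.frenet_fst.hasDerivAt_curve s
  rw [hα] at hT
  have heq := hT.unique hd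
  rw [hφ.tangent_eq] at heq
  obtain ⟨h₁, h₂, h₃⟩ := h.frenet_fst.coeff_eq_zero s
    (a := 1 + ε₁ * ε₂ * lam (σ s) * μ * κ s - deriv σ s * Real.cosh (φ s))
    (b := -(deriv (fun s => lam (σ s)) s * μ))
    (c := deriv σ s * Real.sinh (φ s) - lam (σ s) * μ * τ s)
    (by linear_combination (norm := module) heq)
  refine ⟨sub_eq_zero.mp h₁, ?_, (sub_eq_zero.mp h₃).symm⟩
  simpa [h.mu_ne_zero] using h₂

theorem lam_comp_const
    (h : MannheimPair α β T N B κ τ ε₁ ε₂ T' N' B' κ' τ' ε₁' ε₂' σ lam μ)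
    (hφ : HypAngle T B T' N' σ φ) (s t : ℝ) : lam (σ s) = lam (σ t) :=
  is_const_of_deriv_eq_zero h.differentiable_lam_comp
    (fun s => (h.tangent_components hφ s).2.1) s t

theorem sinh_eq_cosh
    (h : MannheimPair α β T N B κ τ ε₁ ε₂ T' N' B' κ' τ' ε₁' ε₂' σ lam μ)
    (hφ : HypAngle T B T' N' σ φ) (s : ℝ) :
    (1 + ε₁ * ε₂ * lam (σ s) * μ * κ s) * Real.sinh (φ s) =
      lam (σ s) * μ * τ s * Real.cosh (φ s) := by
  obtain ⟨h₁, -, h₃⟩ := h.tangent_components hφ s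
  rw [h₁, h₃]; ring

/-- If the angle is constant, the ratio of curvature to torsion is `ε₁ * tanh φ`. -/
theorem curv_mul_cosh_of_angle_const
    (h : MannheimPair α β T N B κ τ ε₁ ε₂ T' N' B' κ' τ' ε₁' ε₂' σ lam μ)
    (hφ : HypAngle T B T' N' σ φ) (hconst : ∀ s t, φ s = φ t) (s : ℝ) :
    κ s * Real.cosh (φ s) = ε₁ * τ s * Real.sinh (φ s) := by
  have hfun : (T' ∘ σ) = Real.cosh (φ s) • T - Real.sinh (φ s) • B := by
    funext t
    simp [hφ.tangent_eq t, hconst t s]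
  have hd := (h.frenet_snd.hasDerivAt_T (σ s)).scomp s (h.differentiable_repar s).hasDerivAt
  rw [hfun] at hd
  have heq := hd.unique (((h.frenet_fst.hasDerivAt_T s).const_smul (Real.cosh (φ s))).sub
    ((h.frenet_fst.hasDerivAt_B s).const_smul (Real.sinh (φ s))))
  have horth : mink (N' (σ s)) (N s) = 0 := by
    have := h.frenet_snd.inner_NB (σ s)
    rw [h.binormal_eq, mink_comm, mink_smul_left, mink_comm] at this
    exact (mul_eq_zero.mp this).resolve_left h.mu_ne_zero
  have hN : (κ s * Real.cosh (φ s) - ε₁ * τ s * Real.sinh (φ s)) • N s =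
      (deriv σ s * κ' (σ s)) • N' (σ s) := by
    linear_combination (norm := module) -heq
  have := congrArg (mink · (N s)) hN
  simp only [mink_smul_left, horth, h.frenet_fst.inner_NN, mul_zero, mul_eq_zero,
    h.frenet_fst.sign2_ne_zero, or_false] at this
  exact sub_eq_zero.mp this

end MannheimPair


/-- Remark 2: the angle between the tangents is constant iff the curvature and
torsion of `α` are both constant. -/
theorem mannheim_angle_constant_iff
    (α β T N B T' N' B' : ℝ → Fin 3 → ℝ) (κ τ κ' τ' σ lam φ : ℝ → ℝ)
    (ε₁ ε₂ ε₁' ε₂' μ : ℝ)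
    (hpair : MannheimPair α β T N B κ τ ε₁ ε₂ T' N' B' κ' τ' ε₁' ε₂' σ lam μ)
    (hangle : HypAngle T B T' N' σ φ)
    (hlam : ∀ s, lam (σ s) ≠ 0) (hκ : ∀ s, κ s ≠ 0) (hτ : ∀ s, τ s ≠ 0)
    (hne : ∀ s, 1 + ε₁ * ε₂ * lam (σ s) * μ * κ s ≠ 0) :
    (∀ s t, φ s = φ t) ↔ ((∀ s t, κ s = κ t) ∧ (∀ s t, τ s = τ t)) := by
  have hcosh (s : ℝ) : Real.cosh (φ s) ≠ 0 := (Real.cosh_pos _).ne'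
  have hrel := hpair.sinh_eq_cosh hangle
  constructor
  · intro hφ
    have hcurv := hpair.curv_mul_cosh_of_angle_const hangle hφ
    have htors (s : ℝ) : lam (σ s) * μ *
        (Real.cosh (φ s) ^ 2 - ε₂ * Real.sinh (φ s) ^ 2) * τ s =
          Real.sinh (φ s) * Real.cosh (φ s) := by
      linear_combination (-Real.cosh (φ s)) * hrel s +
        ε₁ * ε₂ * lam (σ s) * μ * Real.sinh (φ s) * hcurv s +
        ε₂ * lam (σ s) * μ * Real.sinh (φ s) ^ 2 * τ s * hpair.frenet_fst.sign1_mul_self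
    have hτc (s t : ℝ) : τ s = τ t := by
      have hsinh : Real.sinh (φ s) ≠ 0 := fun h0 => by
        have := hrel s
        rw [h0, mul_zero] at this
        exact mul_ne_zero (mul_ne_zero (mul_ne_zero (hlam s) hpair.mu_ne_zero) (hτ s))
          (hcosh s) this.symm
      have ht := htors t
      rw [hφ t s, hpair.lam_comp_const hangle t s] at ht
      refine mul_left_cancel₀ (left_ne_zero_of_mul (b := τ s) ?_) ((htors s).trans ht.symm)
      rw [htors s]
      exact mul_ne_zero hsinh (hcosh s)
    refine ⟨fun s t => mul_right_cancel₀ (hcosh s) ?_, hτc⟩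
    have ht := hcurv t
    rw [hφ t s, hτc t s] at ht
    rw [hcurv s, ht]
  · rintro ⟨hκc, hτc⟩ s t
    have ht := hrel t
    rw [hκc t s, hτc t s, hpair.lam_comp_const hangle t s] at ht
    have hsub : Real.sinh (φ s - φ t) = 0 := by
      refine mul_left_cancel₀ (hne s) ?_
      rw [Real.sinh_sub]
      linear_combination Real.cosh (φ t) * hrel s - Real.cosh (φ s) * ht
    exact sub_eq_zero.mp (Real.sinh_eq_zero.mp hsub)
end

section
/- Let β : ℝ → ℝ³ be a smooth curve with a Frenet apparatus (T̃, Ñ, B̃, κ̃, τ̃) with signs (ε̃₁, ε̃₂), and let λ be a nonzero real constant. Define α : ℝ → ℝ³ by α(t) = β(t) + λ·B̃(t). Then for all t ∈ ℝ: α′(t) = T̃(t) + λ·ε̃₁·τ̃(t)·Ñ(t), and ⟪α′(t), α′(t)⟫ = ε̃₁ + ε̃₂·λ²·τ̃(t)². In particular, if ε̃₁ + ε̃₂·λ²·τ̃(t)² ≠ 0 for all t, then α′(t) ≠ 0 for all t (α is a regular curve), and at each t the vector α(t) − β(t) is a scalar multiple of B̃(t). -/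
/-- Theorem 1 (regularity part): pushing a Frenet curve a constant distance `λ ≠ 0`
along its binormal yields a curve with `α' = T̃ + λ·ε̃₁·τ̃·Ñ`,
`⟪α',α'⟫ = ε̃₁ + ε̃₂·λ²·τ̃²`; if the latter is nowhere zero then `α` is regular,
and `α − β` is always a scalar multiple of `B̃`. -/
theorem frenet_mannheim_construction_regular
    (β T' N' B' : ℝ → Fin 3 → ℝ) (κ' τ' : ℝ → ℝ) (ε₁' ε₂' : ℝ)
    (hfrenet : FrenetApparatus β T' N' B' κ' τ' ε₁' ε₂')
    (lam : ℝ) (hlam : lam ≠ 0)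
    (α : ℝ → Fin 3 → ℝ) (hα : ∀ t, α t = β t + lam • B' t) :
    (∀ t, deriv α t = T' t + (lam * ε₁' * τ' t) • N' t) ∧
      (∀ t, mink (deriv α t) (deriv α t) = ε₁' + ε₂' * lam ^ 2 * τ' t ^ 2) ∧
      ((∀ t, ε₁' + ε₂' * lam ^ 2 * τ' t ^ 2 ≠ 0) →
        (∀ t, deriv α t ≠ 0) ∧ (∀ t, ∃ c : ℝ, α t - β t = c • B' t)) := by
  have hderiv (t : ℝ) : deriv α t = T' t + (lam * ε₁' * τ' t) • N' t := by
    have hβ : HasDerivAt β (T' t) t := hfrenet.tangent t ▸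
      (hfrenet.smooth_curve.differentiable (by simp) t).hasDerivAt
    have hB : HasDerivAt B' ((ε₁' * τ' t) • N' t) t := hfrenet.frenet_B t ▸
      (hfrenet.smooth_B.differentiable (by simp) t).hasDerivAt
    rw [funext hα, mul_assoc, mul_smul]
    exact (hβ.add (hB.const_smul lam)).deriv
  have hmink (t : ℝ) :
      mink (deriv α t) (deriv α t) = ε₁' + ε₂' * lam ^ 2 * τ' t ^ 2 := by
    have hTT := hfrenet.inner_TT t
    have hTN := hfrenet.inner_TN t
    have hNN := hfrenet.inner_NN t
    have hsq : ε₁' ^ 2 = 1 := by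
      rcases hfrenet.sign1 with h | h <;> simp [h]
    rw [hderiv]
    simp only [mink, Pi.add_apply, Pi.smul_apply, smul_eq_mul] at *
    linear_combination hTT + 2 * (lam * ε₁' * τ' t) * hTN +
      (lam * ε₁' * τ' t) ^ 2 * hNN + ε₂' * lam ^ 2 * τ' t ^ 2 * hsq
  refine ⟨hderiv, hmink, fun h => ⟨fun t h0 => h t ?_, fun t => ⟨lam, ?_⟩⟩⟩
  · rw [← hmink, h0]
    simp [mink]
  · rw [hα, add_sub_cancel_left]
end

section
/- Let α : ℝ → ℝ³ be a smooth curve with a Frenet apparatus (T, N, B, κ, τ) with signs (ε₁, ε₂) such that τ(s) = 0 for all s (a plane curve), let μ ∈ {−1,1}, and let λ be a nonzero real constant such that 1 + ε₁·ε₂·μ·λ·κ(s) ≠ 0 for all s (such λ exists whenever κ is bounded below or bounded above). Define β : ℝ → ℝ³ by β(s) = α(s) − μ·λ·N(s). Then for all s ∈ ℝ: β′(s) = (1 + ε₁·ε₂·μ·λ·κ(s))·T(s); in particular β′(s) ≠ 0 for all s (β is a regular curve), the tangent vector of β at s is a scalar multiple of T(s), and α(s) − β(s) is a scalar multiple of N(s).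 -/
theorem FrenetApparatus.tangent_ne_zero {γ T N B : ℝ → Fin 3 → ℝ} {κ τ : ℝ → ℝ} {ε₁ ε₂ : ℝ}
    (h : FrenetApparatus γ T N B κ τ ε₁ ε₂) (s : ℝ) : T s ≠ 0 := by
  intro h0
  have hT := h.inner_TT s
  rw [h0] at hT
  rcases h.sign1 with h1 | h1 <;> norm_num [mink, h1] at hT

theorem FrenetApparatus.hasDerivAt_sub_smul_normal {γ T N B : ℝ → Fin 3 → ℝ} {κ τ : ℝ → ℝ}
    {ε₁ ε₂ : ℝ} (h : FrenetApparatus γ T N B κ τ ε₁ ε₂) (c s : ℝ) :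
    HasDerivAt (fun t => γ t - c • N t)
      ((1 + ε₁ * ε₂ * c * κ s) • T s - (c * τ s) • B s) s := by
  have hγ := (h.smooth_curve.differentiable (by simp) s).hasDerivAt
  have hN := (h.smooth_N.differentiable (by simp) s).hasDerivAt
  rw [← h.tangent s] at hγ
  rw [h.frenet_N s] at hN
  refine (hγ.sub (hN.const_smul c)).congr_deriv ?_
  module

/-- Theorem 2 (regularity part): for a plane Frenet curve `α` (zero torsion) with
`1 + ε₁ε₂μλκ` nowhere zero, the curve `β = α − μλN` satisfies
`β' = (1 + ε₁ε₂μλκ)·T`; in particular it is regular, its tangent is parallel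
to `T`, and `α − β` is a scalar multiple of `N`. -/
theorem plane_frenet_mannheim_conjugate_regular
    (α T N B : ℝ → Fin 3 → ℝ) (κ τ : ℝ → ℝ) (ε₁ ε₂ : ℝ)
    (hfrenet : FrenetApparatus α T N B κ τ ε₁ ε₂)
    (hτ : ∀ s, τ s = 0) (μ : ℝ) (hμ : μ = 1 ∨ μ = -1)
    (lam : ℝ) (hlam : lam ≠ 0)
    (hne : ∀ s, 1 + ε₁ * ε₂ * μ * lam * κ s ≠ 0)
    (β : ℝ → Fin 3 → ℝ) (hβ : ∀ s, β s = α s - (μ * lam) • N s) :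
    ∀ s, deriv β s = (1 + ε₁ * ε₂ * μ * lam * κ s) • T s ∧
      deriv β s ≠ 0 ∧ (∃ c : ℝ, deriv β s = c • T s) ∧
      (∃ c : ℝ, α s - β s = c • N s) := by
  intro s
  have hderiv : deriv β s = (1 + ε₁ * ε₂ * μ * lam * κ s) • T s := by
    rw [funext hβ, (hfrenet.hasDerivAt_sub_smul_normal (μ * lam) s).deriv, hτ s]
    module
  refine ⟨hderiv, ?_, ⟨_, hderiv⟩, μ * lam, ?_⟩
  · rw [hderiv]
    exact smul_ne_zero (hne s) (hfrenet.tangent_ne_zero s)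
  · rw [hβ s, sub_sub_cancel]
end
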